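/- Let G be a t-intersecting hypergraph on a finite vertex set V, let v* be a new vertex not in V, and let G' be the hypergraph on V ∪ {v*} whose hyperedges are the sets e ∪ {v*} for hyperedges e of G. Then (i) G' is (t+1)-intersecting, and (ii) for any functions h_1, …, h_x : V ∪ {v*} → [b], if every hyperedge e' of G' satisfies |h_i(e')| ≥ min(p+1, |e'|) for some i, then every hyperedge e of G satisfies |h_i(e)| ≥ min(p, |e|) for some i (using the restrictions of the h_i to V). Consequently λ(t+1, p+1, b) ≥ λ(t, p, b). -/

import Mathlib

/-- `G` is a `t`-intersecting hypergraph: any two hyperedges share at least `t` vertices. -/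
def IsIntersecting {V : Type*} [DecidableEq V] (t : ℕ) (G : Finset (Finset V)) : Prop :=
  ∀ e₁ ∈ G, ∀ e₂ ∈ G, t ≤ (e₁ ∩ e₂).card

/-- Theorem 2: adding a fresh vertex `v*` (modelled as `none : Option V`) to every
hyperedge of a `t`-intersecting hypergraph `G` yields a `(t+1)`-intersecting hypergraph
`G'`, and any family of `x` functions that is partially `(p+1)`-perfect for `G'` restricts
(to `V`, via `some`) to a family partially `p`-perfect for `G`. Consequently
`λ(t+1, p+1, b) ≥ λ(t, p, b)`. -/
theorem lambda_monotone_in_t_and_p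
    (t p b x : ℕ)
    (V : Type*) [Fintype V] [DecidableEq V]
    (G : Finset (Finset V)) (hG : IsIntersecting t G) :
    IsIntersecting (t + 1)
        (G.image (fun e => insert (none : Option V) (e.image some))) ∧
    ∀ h : Fin x → Option V → Fin b,
      (∀ e' ∈ G.image (fun e => insert (none : Option V) (e.image some)),
          ∃ i : Fin x, min (p + 1) e'.card ≤ (e'.image (h i)).card) →
      (∀ e ∈ G, ∃ i : Fin x,
          min p e.card ≤ (e.image (fun v => h i (some v))).card) := by
  have card_cone : ∀ e : Finset V, (insert (none : Option V) (e.image some)).card = e.card + 1 := by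
    intro e
    rw [Finset.card_insert_of_notMem (by simp),
      Finset.card_image_of_injective _ (Option.some_injective V)]
  refine ⟨?_, ?_⟩
  · intro e₁' h₁ e₂' h₂
    obtain ⟨e₁, he₁, rfl⟩ := Finset.mem_image.mp h₁
    obtain ⟨e₂, he₂, rfl⟩ := Finset.mem_image.mp h₂
    rw [← Finset.insert_inter_distrib, ← Finset.image_inter _ _ (Option.some_injective V),
      card_cone]
    exact Nat.succ_le_succ (hG e₁ he₁ e₂ he₂)
  · intro h hperf e he
    obtain ⟨i, hi⟩ := hperf _ (Finset.mem_image_of_mem _ he)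
    refine ⟨i, ?_⟩
    rw [card_cone, Finset.image_insert, Finset.image_image] at hi
    have hle := Finset.card_insert_le (h i none) (e.image (h i ∘ some))
    change min p e.card ≤ (e.image (h i ∘ some)).card
    omega
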